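/- arXiv:2511.05842 — 5 statements merged into one kernel-verified Lean document; each statement's English description precedes it below -/
import Mathlib

section
/- Let φ(t) = max(1 − t, 0) be the hinge loss, K^E the Epanechnikov kernel, and h > 0. Then the convolution-smoothed hinge loss φ_h(t) = ∫_ℝ φ(t + h v) K^E(v) dv has the explicit form: φ_h(t) = 1 − t for t ≤ 1 − h; φ_h(t) = 0 for t ≥ 1 + h; and φ_h(t) = h·(−s⁴ + 6 s² + 8 s + 3)/16 with s = (1 − t)/h, for 1 − h ≤ t ≤ 1 + h. -/
open MeasureTheory

/-- The hinge loss `φ(t) = max(1 − t, 0)`. -/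
noncomputable def hinge (t : ℝ) : ℝ := max (1 - t) 0

/-- The Epanechnikov kernel `K^E(u) = (3/4)(1 − u²)` for `|u| ≤ 1`, and `0` otherwise. -/
noncomputable def epan (u : ℝ) : ℝ := if |u| ≤ 1 then (3 / 4) * (1 - u ^ 2) else 0

/-- The convolution-smoothed hinge loss `φ_h(t) = ∫ φ(t + h v) K(v) dv`. -/
noncomputable def smoothedHinge (K : ℝ → ℝ) (h t : ℝ) : ℝ :=
  ∫ v : ℝ, hinge (t + h * v) * K v

/-- If the hinge switches off at `c` within the support of the Epanechnikov kernel, the smoothed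
loss is an elementary polynomial in `c`. -/
theorem smoothedHinge_epan_eq_of_switch {h t c : ℝ} (hc₁ : -1 ≤ c) (hc₂ : c ≤ 1)
    (hle : ∀ v, -1 < v → v ≤ c → t + h * v ≤ 1) (hge : ∀ v, c < v → v < 1 → 1 ≤ t + h * v) :
    smoothedHinge epan h t =
      3 / 4 * ((1 - t) * (c - c ^ 3 / 3 + 2 / 3) - h * (c ^ 2 / 2 - c ^ 4 / 4 - 1 / 4)) := by
  have hfun : (fun v : ℝ => hinge (t + h * v) * epan v) =
      (Set.Ioc (-1) c).indicator fun v => (1 - (t + h * v)) * (3 / 4 * (1 - v ^ 2)) := by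
    funext v
    by_cases hv : v ∈ Set.Ioc (-1) c
    · rw [Set.indicator_of_mem hv, hinge, epan, max_eq_left (by linarith [hle v hv.1 hv.2]),
        if_pos (abs_le.2 ⟨hv.1.le, hv.2.trans hc₂⟩)]
    · rw [Set.indicator_of_notMem hv, epan]
      split_ifs with hv'
      · obtain ⟨h₁, h₂⟩ := abs_le.1 hv'
        rcases h₁.eq_or_lt with rfl | h₁
        · norm_num
        rcases h₂.eq_or_lt with rfl | h₂
        · norm_num
        have hcv : c < v := by
          by_contra! hvc
          exact hv ⟨h₁, hvc⟩
        rw [hinge, max_eq_right (by linarith [hge v hcv h₂]), zero_mul]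
      · exact mul_zero _
  have hderiv : ∀ v ∈ Set.uIcc (-1) c, HasDerivAt
      (fun v : ℝ => 3 / 4 * ((1 - t) * (v - v ^ 3 / 3) - h * (v ^ 2 / 2 - v ^ 4 / 4)))
      ((1 - (t + h * v)) * (3 / 4 * (1 - v ^ 2))) v := by
    intro v _
    have h₁ := ((hasDerivAt_id' v).sub ((hasDerivAt_pow 3 v).div_const 3)).const_mul (1 - t)
    have h₂ := (((hasDerivAt_pow 2 v).div_const 2).sub
      ((hasDerivAt_pow 4 v).div_const 4)).const_mul h
    refine ((h₁.sub h₂).const_mul (3 / 4)).congr_deriv ?_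
    push_cast
    ring
  rw [smoothedHinge, hfun, integral_indicator measurableSet_Ioc,
    ← intervalIntegral.integral_of_le hc₁,
    intervalIntegral.integral_eq_sub_of_hasDerivAt hderiv
      (Continuous.intervalIntegrable (by fun_prop) _ _)]
  ring

/-- Explicit form of the Epanechnikov-smoothed hinge loss. -/
theorem smoothedHinge_epan_explicit (h : ℝ) (hh : 0 < h) :
    (∀ t : ℝ, t ≤ 1 - h → smoothedHinge epan h t = 1 - t) ∧
    (∀ t : ℝ, 1 + h ≤ t → smoothedHinge epan h t = 0) ∧
    (∀ t : ℝ, 1 - h ≤ t → t ≤ 1 + h →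
      smoothedHinge epan h t =
        h * (-((1 - t) / h) ^ 4 + 6 * ((1 - t) / h) ^ 2 + 8 * ((1 - t) / h) + 3) / 16) := by
  refine ⟨fun t ht => ?_, fun t ht => ?_, fun t ht₁ ht₂ => ?_⟩
  · rw [smoothedHinge_epan_eq_of_switch (c := 1) (by norm_num) le_rfl
      (fun v _ hv => by nlinarith) (fun v hv hv' => absurd hv' hv.not_gt)]
    ring
  · rw [smoothedHinge_epan_eq_of_switch (c := -1) le_rfl (by norm_num)
      (fun v hv hv' => absurd hv hv'.not_gt) (fun v hv _ => by nlinarith)]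
    ring
  · have hs : h * ((1 - t) / h) = 1 - t := mul_div_cancel₀ _ hh.ne'
    rw [smoothedHinge_epan_eq_of_switch (c := (1 - t) / h)
      (by rw [le_div_iff₀ hh]; linarith) (by rw [div_le_one hh]; linarith)
      (fun v _ hv => by nlinarith) (fun v hv _ => by nlinarith)]
    field_simp
    ring
end

section
/- Let φ(t) = max(1 − t, 0) be the hinge loss, K^E the Epanechnikov kernel, and h > 0. Then the convolution-smoothed hinge loss φ_h(t) = ∫_ℝ φ(t + h v) K^E(v) dv is differentiable at every t ∈ ℝ, with derivative φ_h′(t) = −∫_{−∞}^{(1−t)/h} K^E(u) du; explicitly, φ_h′(t) = −1 for t ≤ 1 − h, φ_h′(t) = 0 for t ≥ 1 + h, and φ_h′(t) = (s³ − 3s − 2)/4 with s = (1 − t)/h for 1 − h ≤ t ≤ 1 + h. -/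
open MeasureTheory

theorem epan_eq_max (u : ℝ) : epan u = max ((3 / 4) * (1 - u ^ 2)) 0 := by
  unfold epan
  split_ifs with hu
  · rw [max_eq_left]
    nlinarith [(sq_le_one_iff_abs_le_one u).2 hu]
  · rw [max_eq_right]
    have : ¬ u ^ 2 ≤ 1 := fun H => hu ((sq_le_one_iff_abs_le_one u).1 H)
    linarith

theorem epan_eq_indicator :
    epan = (Set.Icc (-1 : ℝ) 1).indicator fun u => (3 / 4) * (1 - u ^ 2) := by
  ext u
  simp only [epan, Set.indicator_apply, Set.mem_Icc, abs_le]

theorem continuous_epan : Continuous epan := by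
  rw [funext epan_eq_max]
  fun_prop

theorem hasCompactSupport_epan : HasCompactSupport epan := by
  refine HasCompactSupport.intro (isCompact_Icc (a := (-1 : ℝ)) (b := 1)) fun u hu => ?_
  rw [epan_eq_indicator, Set.indicator_of_notMem hu]

theorem integrable_epan : Integrable epan :=
  continuous_epan.integrable_of_hasCompactSupport hasCompactSupport_epan

theorem continuous_hinge : Continuous hinge := by
  unfold hinge
  fun_prop

theorem abs_hinge_sub_le (x y : ℝ) : |hinge x - hinge y| ≤ |x - y| := by
  unfold hinge
  refine (abs_max_sub_max_le_abs _ _ _).trans_eq ?_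
  rw [sub_sub_sub_cancel_left, abs_sub_comm]

theorem hasDerivAt_hinge_of_lt {x : ℝ} (hx : x < 1) : HasDerivAt hinge (-1) x := by
  refine ((hasDerivAt_id x).const_sub 1).congr_of_eventuallyEq ?_
  filter_upwards [Iio_mem_nhds hx] with y hy
  exact max_eq_left (sub_nonneg.2 (le_of_lt hy))

theorem hasDerivAt_hinge_of_gt {x : ℝ} (hx : 1 < x) : HasDerivAt hinge 0 x := by
  refine (hasDerivAt_const x (0 : ℝ)).congr_of_eventuallyEq ?_
  filter_upwards [Ioi_mem_nhds hx] with y hy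
  exact max_eq_right (sub_nonpos.2 (le_of_lt hy))

theorem hasDerivAt_smoothedHinge_epan {h : ℝ} (hh : 0 < h) (t : ℝ) :
    HasDerivAt (smoothedHinge epan h) (-(∫ u in Set.Iic ((1 - t) / h), epan u)) t := by
  have hcont (x : ℝ) : Continuous fun v => hinge (x + h * v) * epan v :=
    (continuous_hinge.comp (by fun_prop)).mul continuous_epan
  have key := (hasDerivAt_integral_of_dominated_loc_of_lip (μ := volume)
    (F := fun x v => hinge (x + h * v) * epan v)
    (F' := fun v => -(Set.Iic ((1 - t) / h)).indicator epan v)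
    (x₀ := t) (s := Set.univ) (bound := epan) Filter.univ_mem
    (.of_forall fun x => (hcont x).aestronglyMeasurable)
    ((hcont t).integrable_of_hasCompactSupport hasCompactSupport_epan.mul_left)
    (continuous_epan.aestronglyMeasurable.indicator measurableSet_Iic).neg
    (.of_forall fun v => ?_) integrable_epan ?_).2
  · rwa [integral_neg, integral_indicator measurableSet_Iic] at key
  · refine LipschitzOnWith.of_dist_le_mul fun x _ y _ => ?_
    rw [Real.coe_nnabs, Real.dist_eq, Real.dist_eq, ← sub_mul, abs_mul, mul_comm]
    refine mul_le_mul_of_nonneg_left ((abs_hinge_sub_le _ _).trans_eq ?_) (abs_nonneg _)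
    rw [add_sub_add_right_eq_sub]
  · filter_upwards [Measure.ae_ne volume ((1 - t) / h)] with v hv
    rcases hv.lt_or_gt with hv | hv
    · have hlt : t + h * v < 1 := by
        rw [lt_div_iff₀ hh] at hv
        linarith
      simpa [Set.indicator_of_mem (show v ∈ Set.Iic ((1 - t) / h) from hv.le)] using
        ((hasDerivAt_hinge_of_lt hlt).comp_add_const t (h * v)).mul_const (epan v)
    · have hgt : 1 < t + h * v := by
        rw [div_lt_iff₀ hh] at hv
        linarith
      simpa [Set.indicator_of_notMem (show v ∉ Set.Iic ((1 - t) / h) from not_le.2 hv)] using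
        ((hasDerivAt_hinge_of_gt hgt).comp_add_const t (h * v)).mul_const (epan v)

theorem integral_Iic_epan_of_le {s : ℝ} (hs : s ≤ -1) : ∫ u in Set.Iic s, epan u = 0 := by
  refine setIntegral_eq_zero_of_forall_eq_zero fun u hu => ?_
  rw [epan_eq_max, max_eq_right]
  nlinarith [Set.mem_Iic.1 hu]

theorem integral_Iic_epan_of_mem {s : ℝ} (hs : -1 ≤ s) (hs' : s ≤ 1) :
    ∫ u in Set.Iic s, epan u = -(s ^ 3 - 3 * s - 2) / 4 := by
  have hset : Set.Iic s ∩ Set.Icc (-1) 1 = Set.Icc (-1) s := by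
    ext u
    simp only [Set.mem_inter_iff, Set.mem_Iic, Set.mem_Icc]
    exact ⟨fun H => ⟨H.2.1, H.1⟩, fun H => ⟨H.2, H.1, H.2.trans hs'⟩⟩
  rw [epan_eq_indicator, setIntegral_indicator measurableSet_Icc, hset, integral_Icc_eq_integral_Ioc,
    ← intervalIntegral.integral_of_le hs, intervalIntegral.integral_const_mul,
    intervalIntegral.integral_sub (by simp) (by simp)]
  simp only [intervalIntegral.integral_const, smul_eq_mul, integral_pow]
  ring

theorem integral_Iic_epan_of_ge {s : ℝ} (hs : 1 ≤ s) : ∫ u in Set.Iic s, epan u = 1 := by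
  have hset : Set.Iic s ∩ Set.Icc (-1) 1 = Set.Iic 1 ∩ Set.Icc (-1) 1 := by
    ext u
    simp only [Set.mem_inter_iff, Set.mem_Iic, Set.mem_Icc]
    exact ⟨fun H => ⟨H.2.2, H.2⟩, fun H => ⟨H.1.trans hs, H.2⟩⟩
  have hone := integral_Iic_epan_of_mem (s := 1) (by norm_num) le_rfl
  rw [epan_eq_indicator, setIntegral_indicator measurableSet_Icc] at hone ⊢
  rw [hset, hone]
  norm_num

/-- The Epanechnikov-smoothed hinge loss is everywhere differentiable, with derivative
`φ_h′(t) = −∫_{−∞}^{(1−t)/h} K^E(u) du`, which has the stated explicit piecewise form. -/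
theorem smoothedHinge_epan_hasDerivAt (h : ℝ) (hh : 0 < h) :
    (∀ t : ℝ,
      HasDerivAt (smoothedHinge epan h) (-(∫ u in Set.Iic ((1 - t) / h), epan u)) t) ∧
    (∀ t : ℝ, t ≤ 1 - h → deriv (smoothedHinge epan h) t = -1) ∧
    (∀ t : ℝ, 1 + h ≤ t → deriv (smoothedHinge epan h) t = 0) ∧
    (∀ t : ℝ, 1 - h ≤ t → t ≤ 1 + h →
      deriv (smoothedHinge epan h) t =
        (((1 - t) / h) ^ 3 - 3 * ((1 - t) / h) - 2) / 4) := by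
  refine ⟨hasDerivAt_smoothedHinge_epan hh, fun t ht => ?_, fun t ht => ?_, fun t ht ht' => ?_⟩ <;>
    rw [(hasDerivAt_smoothedHinge_epan hh t).deriv]
  · rw [integral_Iic_epan_of_ge]
    rw [le_div_iff₀ hh]
    linarith
  · rw [integral_Iic_epan_of_le, neg_zero]
    rw [div_le_iff₀ hh]
    linarith
  · rw [integral_Iic_epan_of_mem]
    · ring
    · rw [le_div_iff₀ hh]
      linarith
    · rw [div_le_iff₀ hh]
      linarith
end

section
/- (Weighted-misclassification reformulation of the optimal ITR.) Let (Ω, μ) be a probability space, X : Ω → 𝒳 a measurable map into a measurable space 𝒳, and Q₀, Q₁ : 𝒳 → ℝ measurable functions with Q₀∘X and Q₁∘X integrable; set δ = Q₁ − Q₀. For a measurable decision rule d : 𝒳 → {0,1}, define the value V(d) = E[Q₁(X)·1{d(X)=1} + Q₀(X)·1{d(X)=0}]. Let d*(x) = 1{δ(x) > 0}. Then for every measurable rule d: V(d*) − V(d) = E[|δ(X)|·1{d*(X) ≠ d(X)}] ≥ 0; in particular, d* maximizes V over all measurable rules, and maximizing V is equivalent to minimizing the weighted misclassification error E(|δ(X)|·1[1{δ(X)>0}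 ≠ d(X)]). -/
open MeasureTheory

/-- Choosing between two integrable functions on a measurable set gives an integrable function. -/
lemma integrable_ite_of_measurableSet {Ω : Type*} [MeasurableSpace Ω] {μ : Measure Ω}
    {p : Ω → Prop} [DecidablePred p] (hp : MeasurableSet {ω | p ω}) {f g : Ω → ℝ}
    (hf : Integrable f μ) (hg : Integrable g μ) :
    Integrable (fun ω => if p ω then f ω else g ω) μ :=
  Integrable.piecewise (s := {ω | p ω}) hp hf.integrableOn hg.integrableOn

/-- The pointwise regret of a decision `b` against the sign rule is the weighted error. -/
lemma ite_sub_ite_eq_abs_mul (a₀ a₁ : ℝ) (b : Bool) :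
    (if 0 < a₁ - a₀ then a₁ else a₀) - (if b then a₁ else a₀) =
      |a₁ - a₀| * (if decide (0 < a₁ - a₀) ≠ b then 1 else 0) := by
  by_cases h : 0 < a₁ - a₀
  · cases b <;> simp [h, abs_of_pos h]
  · cases b <;> simp [h, abs_of_nonpos (not_lt.mp h)]

/-- Weighted-misclassification reformulation of the optimal ITR: with
`δ = Q₁ − Q₀` and `d*(x) = 1{δ(x) > 0}`, for every measurable rule `d`,
`V(d*) − V(d) = E[|δ(X)|·1{d*(X) ≠ d(X)}] ≥ 0`; in particular `d*` maximizes the value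
`V(d) = E[Q₁(X)·1{d(X)=1} + Q₀(X)·1{d(X)=0}]`. -/
theorem optimal_ITR_weighted_misclassification
    {Ω 𝒳 : Type*} [MeasurableSpace Ω] [MeasurableSpace 𝒳]
    (μ : Measure Ω) [IsProbabilityMeasure μ]
    (X : Ω → 𝒳) (hX : Measurable X)
    (Q₀ Q₁ : 𝒳 → ℝ) (hQ₀ : Measurable Q₀) (hQ₁ : Measurable Q₁)
    (hQ₀int : Integrable (fun ω => Q₀ (X ω)) μ)
    (hQ₁int : Integrable (fun ω => Q₁ (X ω)) μ) :
    ∀ d : 𝒳 → Bool, Measurable d →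
      ((∫ ω, (if 0 < Q₁ (X ω) - Q₀ (X ω) then Q₁ (X ω) else Q₀ (X ω)) ∂μ) -
          (∫ ω, (if d (X ω) then Q₁ (X ω) else Q₀ (X ω)) ∂μ) =
        ∫ ω, |Q₁ (X ω) - Q₀ (X ω)| *
          (if decide (0 < Q₁ (X ω) - Q₀ (X ω)) ≠ d (X ω) then 1 else 0) ∂μ) ∧
      (0 ≤ ∫ ω, |Q₁ (X ω) - Q₀ (X ω)| *
          (if decide (0 < Q₁ (X ω) - Q₀ (X ω)) ≠ d (X ω) then 1 else 0) ∂μ) ∧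
      ((∫ ω, (if d (X ω) then Q₁ (X ω) else Q₀ (X ω)) ∂μ) ≤
        ∫ ω, (if 0 < Q₁ (X ω) - Q₀ (X ω) then Q₁ (X ω) else Q₀ (X ω)) ∂μ) := by
  intro d hd
  have h_opt : Integrable
      (fun ω => if 0 < Q₁ (X ω) - Q₀ (X ω) then Q₁ (X ω) else Q₀ (X ω)) μ :=
    integrable_ite_of_measurableSet
      (measurableSet_lt measurable_const ((hQ₁.comp hX).sub (hQ₀.comp hX))) hQ₁int hQ₀int
  have h_rule : Integrable (fun ω => if d (X ω) then Q₁ (X ω) else Q₀ (X ω)) μ :=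
    integrable_ite_of_measurableSet
      ((hd.comp hX) (measurableSet_singleton true)) hQ₁int hQ₀int
  have h_eq : (∫ ω, (if 0 < Q₁ (X ω) - Q₀ (X ω) then Q₁ (X ω) else Q₀ (X ω)) ∂μ) -
      (∫ ω, (if d (X ω) then Q₁ (X ω) else Q₀ (X ω)) ∂μ) =
      ∫ ω, |Q₁ (X ω) - Q₀ (X ω)| *
        (if decide (0 < Q₁ (X ω) - Q₀ (X ω)) ≠ d (X ω) then 1 else 0) ∂μ := by
    rw [← integral_sub h_opt h_rule]
    exact integral_congr_ae (.of_forall fun ω => ite_sub_ite_eq_abs_mul _ _ _)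
  have h_nonneg : 0 ≤ ∫ ω, |Q₁ (X ω) - Q₀ (X ω)| *
      (if decide (0 < Q₁ (X ω) - Q₀ (X ω)) ≠ d (X ω) then 1 else 0) ∂μ :=
    integral_nonneg fun ω => mul_nonneg (abs_nonneg _) (by split_ifs <;> norm_num)
  exact ⟨h_eq, h_nonneg, sub_nonneg.mp (h_eq ▸ h_nonneg)⟩
end

section
/- (Lemma 3, part 1: Fisher consistency of the weighted hinge loss.) Let (𝒳, μ) be a probability space and δ : 𝒳 → ℝ a measurable, integrable function. Set Z(x) = 2·1{δ(x) > 0} − 1. For a measurable f : 𝒳 → ℝ, define the value V(f, δ) = ∫ |δ(x)|·1[1{δ(x)>0} = 1{f(x)>0}] dμ(x) and the weighted hinge risk Q(f, δ) = ∫ |δ(x)|·max(1 − Z(x) f(x), 0) dμ(x). If f* is measurable with Q(f*, δ) ≤ Q(f, δ) for every measurable f (with Q(f*, δ) finite), then V(f*, δ) ≥ V(f, δ) for every measurable f; that is, f* yields the maximum value. -/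
open MeasureTheory

/-- Lemma 3 (part 1): Fisher consistency of the weighted hinge loss. With pseudo-category
`Z(x) = 2·1{δ(x)>0} − 1`, value `V(f,δ) = ∫ |δ|·1[1{δ>0} = 1{f>0}] dμ`, and weighted hinge
risk `Q(f,δ) = ∫ |δ|·max(1 − Z f, 0) dμ` (taken as a Lebesgue integral so that it may be
infinite), if a measurable `f*` with finite risk minimizes `Q(·,δ)` over all measurable
functions, then `f*` maximizes the value `V(·,δ)` over all measurable functions. -/
theorem weighted_hinge_fisher_consistency
    {𝒳 : Type*} [MeasurableSpace 𝒳] (μ : Measure 𝒳) [IsProbabilityMeasure μ]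
    (δ : 𝒳 → ℝ) (hδmeas : Measurable δ) (hδint : Integrable δ μ)
    (fstar : 𝒳 → ℝ) (hfstar : Measurable fstar)
    (hfin : (∫⁻ x, ENNReal.ofReal
        (|δ x| * max (1 - (2 * (if 0 < δ x then (1 : ℝ) else 0) - 1) * fstar x) 0) ∂μ) ≠ ⊤)
    (hmin : ∀ f : 𝒳 → ℝ, Measurable f →
      (∫⁻ x, ENNReal.ofReal
          (|δ x| * max (1 - (2 * (if 0 < δ x then (1 : ℝ) else 0) - 1) * fstar x) 0) ∂μ) ≤
        ∫⁻ x, ENNReal.ofReal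
          (|δ x| * max (1 - (2 * (if 0 < δ x then (1 : ℝ) else 0) - 1) * f x) 0) ∂μ) :
    ∀ f : 𝒳 → ℝ, Measurable f →
      (∫ x, |δ x| * (if (0 < δ x ↔ 0 < f x) then 1 else 0) ∂μ) ≤
        ∫ x, |δ x| * (if (0 < δ x ↔ 0 < fstar x) then 1 else 0) ∂μ := by
  intro f _
  have hZ : Measurable fun x => 2 * (if 0 < δ x then (1 : ℝ) else 0) - 1 :=
    ((Measurable.ite (measurableSet_lt measurable_const hδmeas)
      measurable_const measurable_const).const_mul 2).sub_const 1
  -- The pseudo-category itself has zero risk, so the minimal risk vanishes.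
  have hzero : (∫⁻ x, ENNReal.ofReal
      (|δ x| * max (1 - (2 * (if 0 < δ x then (1 : ℝ) else 0) - 1) * fstar x) 0) ∂μ) = 0 := by
    refine le_antisymm ((hmin _ hZ).trans (le_of_eq ?_)) zero_le
    refine (lintegral_congr fun x => ?_).trans lintegral_zero
    split_ifs <;> norm_num
  have hmeas : Measurable fun x => ENNReal.ofReal
      (|δ x| * max (1 - (2 * (if 0 < δ x then (1 : ℝ) else 0) - 1) * fstar x) 0) :=
    ((continuous_abs.measurable.comp hδmeas).mul
      (((hZ.mul hfstar).const_sub 1).max measurable_const)).ennreal_ofReal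
  have hae : ∀ᵐ x ∂μ, |δ x| * (if (0 < δ x ↔ 0 < fstar x) then (1 : ℝ) else 0) = |δ x| := by
    filter_upwards [(lintegral_eq_zero_iff hmeas).1 hzero] with x hx
    rcases eq_or_ne (δ x) 0 with h0 | h0
    · simp [h0]
    have hpos : 0 < |δ x| := abs_pos.2 h0
    have hmul := ENNReal.ofReal_eq_zero.1 hx
    have hle : 1 - (2 * (if 0 < δ x then (1 : ℝ) else 0) - 1) * fstar x ≤ 0 :=
      (le_max_left _ 0).trans (nonpos_of_mul_nonpos_right hmul hpos)
    have hiff : 0 < δ x ↔ 0 < fstar x := by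
      split_ifs at hle with h
      · exact iff_of_true h (by linarith)
      · exact iff_of_false h (by linarith)
    rw [if_pos hiff, mul_one]
  refine integral_mono_of_nonneg (Filter.Eventually.of_forall fun x => ?_)
    (hδint.abs.congr (hae.mono fun _ h => h.symm)) ?_
  · exact mul_nonneg (abs_nonneg _) (by split_ifs <;> norm_num)
  · filter_upwards [hae] with x hx
    rw [hx]
    exact mul_le_of_le_one_right (abs_nonneg _) (by split_ifs <;> norm_num)
end

section
/- (Lemma 3, part 2: value loss is bounded by the excess hinge risk.) Let (𝒳, μ) be a probability space and δ : 𝒳 → ℝ a measurable, integrable function. Set Z(x) = 2·1{δ(x) > 0} − 1, and for measurable f : 𝒳 → ℝ define V(f, δ) = ∫ |δ(x)|·1[1{δ(x)>0} = 1{f(x)>0}] dμ(x) and Q(f, δ) = ∫ |δ(x)|·max(1 − Z(x) f(x), 0) dμ(x). If f* is measurable with Q(f*, δ) ≤ Q(f, δ) for every measurable f (and Q(f*, δ) finite), then for every measurable f with Q(f, δ) finite: V(f*, δ) − V(f, δ) ≤ Q(f, δ) − Q(f*, δ). -/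
open MeasureTheory

/-- The pseudo-category itself has zero hinge loss. -/
theorem max_one_sub_pseudoCategory_mul_self (d : ℝ) :
    max (1 - (2 * (if 0 < d then (1 : ℝ) else 0) - 1) *
      (2 * (if 0 < d then (1 : ℝ) else 0) - 1)) 0 = 0 := by
  split_ifs <;> norm_num

/-- The hinge loss dominates the zero-one loss. -/
theorem one_le_indicator_agree_add_hinge (d y : ℝ) :
    1 ≤ (if (0 < d ↔ 0 < y) then (1 : ℝ) else 0) +
      max (1 - (2 * (if 0 < d then (1 : ℝ) else 0) - 1) * y) 0 := by
  have h := le_max_left (1 - (2 * (if 0 < d then (1 : ℝ) else 0) - 1) * y) 0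
  have h0 := le_max_right (1 - (2 * (if 0 < d then (1 : ℝ) else 0) - 1) * y) 0
  by_cases hd : 0 < d <;> by_cases hy : 0 < y <;> simp only [hd, hy, if_true, if_false, iff_self,
    iff_false, iff_true, not_true_eq_false] at h h0 ⊢ <;> linarith

/-- The integrand of the value function is integrable. -/
theorem integrable_abs_mul_indicator_agree {𝒳 : Type*} [MeasurableSpace 𝒳] {μ : Measure 𝒳}
    {δ f : 𝒳 → ℝ} (hδmeas : Measurable δ) (hδint : Integrable δ μ) (hf : Measurable f) :
    Integrable (fun x => |δ x| * (if (0 < δ x ↔ 0 < f x) then (1 : ℝ) else 0)) μ := by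
  have hset : MeasurableSet {x | 0 < δ x ↔ 0 < f x} :=
    (measurableSet_lt measurable_const hδmeas).iff (measurableSet_lt measurable_const hf)
  have hind : Measurable fun x => if (0 < δ x ↔ 0 < f x) then (1 : ℝ) else 0 :=
    Measurable.ite hset measurable_const measurable_const
  refine hδint.abs.mono' (hδmeas.abs.mul hind).aestronglyMeasurable (.of_forall fun x => ?_)
  split_ifs <;> simp

/-- Lemma 3 (part 2): the value loss is bounded by the excess hinge risk. With pseudo-category
`Z(x) = 2·1{δ(x)>0} − 1`, value `V(f,δ) = ∫ |δ|·1[1{δ>0} = 1{f>0}] dμ`, and weighted hinge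
risk `Q(f,δ) = ∫ |δ|·max(1 − Z f, 0) dμ` (taken as a Lebesgue integral so that it may be
infinite), if a measurable `f*` with finite risk minimizes `Q(·,δ)` over all measurable
functions, then for every measurable `f` with finite risk,
`V(f*,δ) − V(f,δ) ≤ Q(f,δ) − Q(f*,δ)`. -/
theorem value_loss_le_excess_hinge_risk
    {𝒳 : Type*} [MeasurableSpace 𝒳] (μ : Measure 𝒳) [IsProbabilityMeasure μ]
    (δ : 𝒳 → ℝ) (hδmeas : Measurable δ) (hδint : Integrable δ μ)
    (fstar : 𝒳 → ℝ) (hfstar : Measurable fstar)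
    (hfin : (∫⁻ x, ENNReal.ofReal
        (|δ x| * max (1 - (2 * (if 0 < δ x then (1 : ℝ) else 0) - 1) * fstar x) 0) ∂μ) ≠ ⊤)
    (hmin : ∀ f : 𝒳 → ℝ, Measurable f →
      (∫⁻ x, ENNReal.ofReal
          (|δ x| * max (1 - (2 * (if 0 < δ x then (1 : ℝ) else 0) - 1) * fstar x) 0) ∂μ) ≤
        ∫⁻ x, ENNReal.ofReal
          (|δ x| * max (1 - (2 * (if 0 < δ x then (1 : ℝ) else 0) - 1) * f x) 0) ∂μ) :
    ∀ f : 𝒳 → ℝ, Measurable f →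
      (∫⁻ x, ENNReal.ofReal
          (|δ x| * max (1 - (2 * (if 0 < δ x then (1 : ℝ) else 0) - 1) * f x) 0) ∂μ) ≠ ⊤ →
      (∫ x, |δ x| * (if (0 < δ x ↔ 0 < fstar x) then 1 else 0) ∂μ) -
          (∫ x, |δ x| * (if (0 < δ x ↔ 0 < f x) then 1 else 0) ∂μ) ≤
        (∫⁻ x, ENNReal.ofReal
            (|δ x| * max (1 - (2 * (if 0 < δ x then (1 : ℝ) else 0) - 1) * f x) 0) ∂μ).toReal -
          (∫⁻ x, ENNReal.ofReal
            (|δ x| * max (1 - (2 * (if 0 < δ x then (1 : ℝ) else 0) - 1) * fstar x) 0) ∂μ).toReal := by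
  have hZ : Measurable fun x => 2 * (if 0 < δ x then (1 : ℝ) else 0) - 1 :=
    ((Measurable.ite (measurableSet_lt measurable_const hδmeas)
      measurable_const measurable_const).const_mul 2).sub_const 1
  have hstar : (∫⁻ x, ENNReal.ofReal
      (|δ x| * max (1 - (2 * (if 0 < δ x then (1 : ℝ) else 0) - 1) * fstar x) 0) ∂μ) = 0 := by
    simpa only [max_one_sub_pseudoCategory_mul_self, mul_zero, ENNReal.ofReal_zero,
      lintegral_zero, nonpos_iff_eq_zero] using hmin _ hZ
  intro f hf hfinf
  rw [hstar, ENNReal.toReal_zero, sub_zero]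
  have hmeas : AEStronglyMeasurable
      (fun x => |δ x| * max (1 - (2 * (if 0 < δ x then (1 : ℝ) else 0) - 1) * f x) 0) μ :=
    (hδmeas.abs.mul (((hZ.mul hf).const_sub 1).max measurable_const)).aestronglyMeasurable
  have hnonneg : 0 ≤ᵐ[μ]
      fun x => |δ x| * max (1 - (2 * (if 0 < δ x then (1 : ℝ) else 0) - 1) * f x) 0 :=
    .of_forall fun x => mul_nonneg (abs_nonneg _) (le_max_right _ _)
  have hint := (lintegral_ofReal_ne_top_iff_integrable hmeas hnonneg).1 hfinf
  have hVf := integrable_abs_mul_indicator_agree hδmeas hδint hf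
  rw [← integral_eq_lintegral_of_nonneg_ae hnonneg hmeas, sub_le_iff_le_add',
    ← integral_add hVf hint]
  refine integral_mono (integrable_abs_mul_indicator_agree hδmeas hδint hfstar)
    (hVf.add hint) fun x => ?_
  calc |δ x| * (if (0 < δ x ↔ 0 < fstar x) then (1 : ℝ) else 0) ≤ |δ x| * 1 := by
        gcongr; split_ifs <;> norm_num
    _ ≤ |δ x| * ((if (0 < δ x ↔ 0 < f x) then (1 : ℝ) else 0) +
          max (1 - (2 * (if 0 < δ x then (1 : ℝ) else 0) - 1) * f x) 0) := by
        gcongr; exact one_le_indicator_agree_add_hinge _ _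
    _ = _ := mul_add _ _ _
end
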